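/- (Maximum-position rule) Let U be an upper bound on the optimal total service disruption time, i.e., U ≥ min over all repair sequences τ of T(τ). If for some vertex i ∈ V_c and some position k with n − |S_i| < k ≤ n one has L_i^k > U, then every optimal repair sequence σ (one with T(σ) = min over all repair sequences τ of T(τ)) visits vertex i strictly before position k, i.e., σ^{-1}(i) < k. -/

import Mathlib

/-- `W n pre S` is the number of vertices of `V_c = {1,…,n}` without power service
when exactly the vertices in `S` have been repaired: vertices `j` having some
predecessor-or-self `i` (i.e. `pre i j`) that is not in `S`. -/
noncomputable def W (n : ℕ) (pre : ℕ → ℕ → Prop) (S : Finset ℕ) : ℕ :=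
  {j | j ∈ Finset.Icc 1 n ∧ ∃ i ∈ Finset.Icc 1 n, pre i j ∧ i ∉ S}.ncard

/-- `jseq σ p` is the `p`-th visited vertex: the depot `0` for `p = 0`, and `σ p` otherwise. -/
def jseq (σ : ℕ → ℕ) (p : ℕ) : ℕ := if p = 0 then 0 else σ p

/-- Arrival time at the `p`-th visited vertex: `t_p = ∑_{q=1}^p d(j_{q-1}, j_q)`. -/
def arrival (d : ℕ → ℕ → ℝ) (σ : ℕ → ℕ) (p : ℕ) : ℝ :=
  ∑ q ∈ Finset.Icc 1 p, d (jseq σ (q - 1)) (jseq σ q)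

/-- `lastPos n pre σ i = max { p ∈ [1,n] : σ p ⪰ i }`, the position at which the
service of vertex `i` is restored. -/
noncomputable def lastPos (n : ℕ) (pre : ℕ → ℕ → Prop) (σ : ℕ → ℕ) (i : ℕ) : ℕ :=
  sSup {p : ℕ | p ∈ Finset.Icc 1 n ∧ pre (σ p) i}

/-- Total service disruption time `T(σ) = ∑_{i ∈ V_c} r_i` where `r_i = t_{p(i)}`. -/
noncomputable def totalT (n : ℕ) (d : ℕ → ℕ → ℝ) (pre : ℕ → ℕ → Prop) (σ : ℕ → ℕ) : ℝ :=
  ∑ i ∈ Finset.Icc 1 n, arrival d σ (lastPos n pre σ i)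

/-- `Scard n pre i = |S_i|`, the number of successors of `i` in the power network,
including `i` itself. -/
noncomputable def Scard (n : ℕ) (pre : ℕ → ℕ → Prop) (i : ℕ) : ℕ :=
  {j | j ∈ Finset.Icc 1 n ∧ pre i j}.ncard

/-- The multiset of all arc lengths `d(i,j)` over ordered pairs of distinct vertices of `V`. -/
def arcLengths (n : ℕ) (d : ℕ → ℕ → ℝ) : Multiset ℝ :=
  ((Finset.Icc 0 n ×ˢ Finset.Icc 0 n).filter fun x => x.1 ≠ x.2).val.map fun x => d x.1 x.2

/-- `sArc n d p` is the `p`-th smallest arc length (counted with multiplicity). -/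
noncomputable def sArc (n : ℕ) (d : ℕ → ℕ → ℝ) (p : ℕ) : ℝ :=
  ((arcLengths n d).sort (· ≤ ·)).getD (p - 1) 0

/-- The position-based lower bound
`L_i^k = ∑_{p=1}^{n−|S_i|} (n−p+1) s_p + ∑_{p=k+1}^{n} (n−p+1) s_p + |S_i| · ∑_{p=n−|S_i|+1}^{k} s_p`. -/
noncomputable def Lik (n : ℕ) (d : ℕ → ℕ → ℝ) (pre : ℕ → ℕ → Prop) (i k : ℕ) : ℝ :=
  (∑ p ∈ Finset.Icc 1 (n - Scard n pre i), ((n - p + 1 : ℕ) : ℝ) * sArc n d p)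
    + (∑ p ∈ Finset.Icc (k + 1) n, ((n - p + 1 : ℕ) : ℝ) * sArc n d p)
    + (Scard n pre i : ℝ) * ∑ p ∈ Finset.Icc (n - Scard n pre i + 1) k, sArc n d p

/-- Abel summation bound: antitone weights against a sequence with nonnegative partial sums. -/
theorem mul_sum_le_sum_mul_of_antitone {w x : ℕ → ℝ} {N : ℕ} (hN : 1 ≤ N)
    (hw : ∀ p, 1 ≤ p → p < N → w (p + 1) ≤ w p)
    (hx : ∀ P, P ≤ N → 0 ≤ ∑ p ∈ Finset.Icc 1 P, x p) :
    w N * ∑ p ∈ Finset.Icc 1 N, x p ≤ ∑ p ∈ Finset.Icc 1 N, w p * x p := by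
  induction N, hN using Nat.le_induction with
  | base => simp
  | succ N hN ih =>
    have h := ih (fun p h1 h2 => hw p h1 (by omega)) (fun P hP => hx P (by omega))
    have h' := mul_le_mul_of_nonneg_right (hw N hN (by omega)) (hx N (by omega))
    rw [Finset.sum_Icc_succ_top (by omega), Finset.sum_Icc_succ_top (by omega), mul_add]
    linarith

/-- The sum of a submultiset is at least the sum of equally many smallest elements. -/
theorem sum_sort_getD_le_sum {A m : Multiset ℝ} (h : m ≤ A) :
    ∑ p ∈ Finset.Icc 1 m.card, (A.sort (· ≤ ·)).getD (p - 1) 0 ≤ m.sum := by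
  have hsub : (m.sort (· ≤ ·)).Sublist (A.sort (· ≤ ·)) := by
    refine List.sublist_of_subperm_of_pairwise ?_ (Multiset.pairwise_sort m _)
      (Multiset.pairwise_sort A _)
    rwa [← Multiset.coe_le, Multiset.sort_eq, Multiset.sort_eq]
  obtain ⟨f, hf⟩ := List.sublist_iff_exists_orderEmbedding_getElem?_eq.1 hsub
  have hsum : m.sum = ∑ p ∈ Finset.range m.card, (m.sort (· ≤ ·)).getD p 0 := by
    conv_lhs => rw [← Multiset.sort_eq m (· ≤ ·), Multiset.sum_coe]
    rw [← Multiset.length_sort (s := m) (r := (· ≤ ·)), Finset.sum_range,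
      ← Fin.sum_univ_getElem]
    simp only [List.getD_eq_getElem _ _ (Fin.is_lt _)]
  rw [hsum, ← Finset.Ico_add_one_right_eq_Icc, Finset.sum_Ico_eq_sum_range, Nat.add_sub_cancel]
  refine Finset.sum_le_sum fun p hp => ?_
  rw [Finset.mem_range, ← Multiset.length_sort (s := m) (r := (· ≤ ·))] at hp
  have hfp := hf p
  rw [List.getElem?_eq_getElem hp] at hfp
  obtain ⟨hlt, heq⟩ := List.getElem?_eq_some_iff.1 hfp.symm
  have hle : p ≤ f p := f.strictMono.le_apply
  rw [Nat.add_sub_cancel_left, List.getD_eq_getElem _ _ hp,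
    List.getD_eq_getElem _ _ (hle.trans_lt hlt), ← heq]
  exact (Multiset.pairwise_sort A (· ≤ ·)).sortedLE.getElem_le_getElem_of_le hle

theorem jseq_injOn {n : ℕ} {σ : ℕ → ℕ} (hσ : Set.BijOn σ (Set.Icc 1 n) (Set.Icc 1 n)) :
    Set.InjOn (jseq σ) (Set.Icc 0 n) := by
  intro a ha b hb hab
  simp only [Set.mem_Icc] at ha hb
  have hpos : ∀ p, 1 ≤ p → p ≤ n → 1 ≤ σ p := fun p h1 h2 => (hσ.mapsTo ⟨h1, h2⟩).1
  unfold jseq at hab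
  split_ifs at hab with h1 h2 h2
  · omega
  · have := hpos b (by omega) hb.2; omega
  · have := hpos a (by omega) ha.2; omega
  · exact hσ.injOn ⟨by omega, ha.2⟩ ⟨by omega, hb.2⟩ hab

theorem jseq_le {n : ℕ} {σ : ℕ → ℕ} (hσ : Set.BijOn σ (Set.Icc 1 n) (Set.Icc 1 n))
    {p : ℕ} (hp : p ≤ n) : jseq σ p ≤ n := by
  unfold jseq
  split_ifs with h
  · omega
  · exact (hσ.mapsTo ⟨by omega, hp⟩).2

/-- The first `P` arcs travelled are at least as long in total as the `P` shortest arcs. -/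
theorem sum_sArc_le_arrival {n : ℕ} (d : ℕ → ℕ → ℝ) {σ : ℕ → ℕ}
    (hσ : Set.BijOn σ (Set.Icc 1 n) (Set.Icc 1 n)) {P : ℕ} (hP : P ≤ n) :
    ∑ p ∈ Finset.Icc 1 P, sArc n d p ≤ arrival d σ P := by
  let e : ℕ → ℕ × ℕ := fun q => (jseq σ (q - 1), jseq σ q)
  have hinj : Set.InjOn e (Finset.Icc 1 P) := by
    intro a ha b hb hab
    simp only [Finset.coe_Icc, Set.mem_Icc] at ha hb
    exact jseq_injOn hσ ⟨by omega, by omega⟩ ⟨by omega, by omega⟩ (Prod.ext_iff.1 hab).2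
  have hsub : (Finset.Icc 1 P).image e ⊆
      (Finset.Icc 0 n ×ˢ Finset.Icc 0 n).filter fun x => x.1 ≠ x.2 := by
    intro x hx
    obtain ⟨q, hq, rfl⟩ := Finset.mem_image.1 hx
    rw [Finset.mem_Icc] at hq
    simp only [Finset.mem_filter, Finset.mem_product, Finset.mem_Icc, e]
    refine ⟨⟨⟨Nat.zero_le _, jseq_le hσ (by omega)⟩, Nat.zero_le _, jseq_le hσ (by omega)⟩,
      fun h => ?_⟩
    have := jseq_injOn hσ ⟨by omega, by omega⟩ ⟨by omega, by omega⟩ h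
    omega
  have hle := sum_sort_getD_le_sum
    (Multiset.map_le_map (f := fun x : ℕ × ℕ => d x.1 x.2) (Finset.val_le_iff.2 hsub))
  have hcard : ((Finset.Icc 1 P).image e).card = P := by
    rw [Finset.card_image_of_injOn hinj, Nat.card_Icc, Nat.add_sub_cancel]
  rw [Multiset.card_map, Finset.card_val, hcard] at hle
  refine hle.trans_eq ?_
  exact Finset.sum_image (f := fun x : ℕ × ℕ => d x.1 x.2) hinj

theorem finite_restoring_positions (n : ℕ) (pre : ℕ → ℕ → Prop) (σ : ℕ → ℕ) (j : ℕ) :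
    {p : ℕ | p ∈ Finset.Icc 1 n ∧ pre (σ p) j}.Finite :=
  (Finset.Icc 1 n).finite_toSet.subset fun _ h => h.1

theorem le_lastPos {n : ℕ} {pre : ℕ → ℕ → Prop} {σ : ℕ → ℕ} {j p : ℕ}
    (hp : p ∈ Finset.Icc 1 n) (h : pre (σ p) j) : p ≤ lastPos n pre σ j :=
  le_csSup (finite_restoring_positions n pre σ j).bddAbove ⟨hp, h⟩

theorem lastPos_le (n : ℕ) (pre : ℕ → ℕ → Prop) (σ : ℕ → ℕ) (j : ℕ) :
    lastPos n pre σ j ≤ n :=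
  csSup_le' fun _ h => (Finset.mem_Icc.1 h.1).2

/-- The total service disruption time, summed arc by arc. -/
theorem totalT_eq_sum_card_mul (n : ℕ) (d : ℕ → ℕ → ℝ) (pre : ℕ → ℕ → Prop) (σ : ℕ → ℕ) :
    totalT n d pre σ = ∑ p ∈ Finset.Icc 1 n,
      (((Finset.Icc 1 n).filter fun j => p ≤ lastPos n pre σ j).card : ℝ) *
        d (jseq σ (p - 1)) (jseq σ p) := by
  have harr : ∀ j, arrival d σ (lastPos n pre σ j) = ∑ p ∈ Finset.Icc 1 n,
      if p ≤ lastPos n pre σ j then d (jseq σ (p - 1)) (jseq σ p) else 0 := by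
    intro j
    rw [← Finset.sum_filter, arrival]
    refine Finset.sum_congr ?_ fun _ _ => rfl
    ext p
    have := lastPos_le n pre σ j
    simp only [Finset.mem_filter, Finset.mem_Icc]
    omega
  unfold totalT
  simp_rw [harr]
  rw [Finset.sum_comm]
  refine Finset.sum_congr rfl fun p _ => ?_
  rw [← Finset.sum_filter, Finset.sum_const, nsmul_eq_mul]

theorem sub_add_one_le_card_lastPos {n : ℕ} {pre : ℕ → ℕ → Prop}
    (hrefl : ∀ i ∈ Finset.Icc 1 n, pre i i) {σ : ℕ → ℕ}
    (hσ : Set.BijOn σ (Set.Icc 1 n) (Set.Icc 1 n)) {p : ℕ} (hp : p ∈ Finset.Icc 1 n) :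
    n - p + 1 ≤ ((Finset.Icc 1 n).filter fun j => p ≤ lastPos n pre σ j).card := by
  rw [Finset.mem_Icc] at hp
  have hinj : Set.InjOn σ (Finset.Icc p n) := hσ.injOn.mono fun q hq => by
    simp only [Finset.coe_Icc, Set.mem_Icc] at hq ⊢
    omega
  have hcard : ((Finset.Icc p n).image σ).card = n - p + 1 := by
    rw [Finset.card_image_of_injOn hinj, Nat.card_Icc]
    omega
  rw [← hcard]
  refine Finset.card_le_card fun j hj => ?_
  obtain ⟨q, hq, rfl⟩ := Finset.mem_image.1 hj
  rw [Finset.mem_Icc] at hq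
  have hmem : σ q ∈ Finset.Icc 1 n := Finset.mem_Icc.2 (hσ.mapsTo ⟨by omega, hq.2⟩)
  exact Finset.mem_filter.2 ⟨hmem, hq.1.trans
    (le_lastPos (Finset.mem_Icc.2 ⟨by omega, hq.2⟩) (hrefl _ hmem))⟩

theorem Scard_le_card_lastPos {n : ℕ} {pre : ℕ → ℕ → Prop} {σ : ℕ → ℕ} {p q : ℕ}
    (hq : q ∈ Finset.Icc 1 n) (hpq : p ≤ q) :
    Scard n pre (σ q) ≤ ((Finset.Icc 1 n).filter fun j => p ≤ lastPos n pre σ j).card := by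
  rw [Scard, ← Set.ncard_coe_finset]
  refine Set.ncard_le_ncard (fun j hj => ?_) (Finset.finite_toSet _)
  exact Finset.mem_coe.2 (Finset.mem_filter.2 ⟨hj.1, hpq.trans (le_lastPos hq hj.2)⟩)

theorem Scard_le (n : ℕ) (pre : ℕ → ℕ → Prop) (i : ℕ) : Scard n pre i ≤ n := by
  have h : Scard n pre i ≤ ((Finset.Icc 1 n : Finset ℕ) : Set ℕ).ncard :=
    Set.ncard_le_ncard (fun j hj => hj.1) (Finset.finite_toSet _)
  rwa [Set.ncard_coe_finset, Nat.card_Icc, Nat.add_sub_cancel] at h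

/-- The weight of the `p`-th shortest arc in `Lik`. -/
noncomputable def likWeight (n : ℕ) (pre : ℕ → ℕ → Prop) (i k p : ℕ) : ℕ :=
  if n - Scard n pre i < p ∧ p ≤ k then Scard n pre i else n - p + 1

theorem Lik_eq_sum_likWeight {n : ℕ} (d : ℕ → ℕ → ℝ) {pre : ℕ → ℕ → Prop} {i k : ℕ}
    (hk1 : n - Scard n pre i < k) (hk2 : k ≤ n) :
    Lik n d pre i k = ∑ p ∈ Finset.Icc 1 n, (likWeight n pre i k p : ℝ) * sArc n d p := by
  simp only [Lik, ← Finset.Ico_add_one_right_eq_Icc]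
  rw [← Finset.sum_Ico_consecutive _ (show 1 ≤ n - Scard n pre i + 1 by omega)
      (show n - Scard n pre i + 1 ≤ n + 1 by omega),
    ← Finset.sum_Ico_consecutive _ (show n - Scard n pre i + 1 ≤ k + 1 by omega)
      (show k + 1 ≤ n + 1 by omega), Finset.mul_sum, add_assoc]
  congr 1
  · refine Finset.sum_congr rfl fun p hp => ?_
    rw [Finset.mem_Ico] at hp
    rw [likWeight, if_neg (by omega)]
  · rw [add_comm]
    congr 1 <;> refine Finset.sum_congr rfl fun p hp => ?_ <;> rw [Finset.mem_Ico] at hp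
    · rw [likWeight, if_pos (by omega)]
    · rw [likWeight, if_neg (by omega)]

theorem likWeight_succ_le {n : ℕ} {pre : ℕ → ℕ → Prop} {i k p : ℕ}
    (hk1 : n - Scard n pre i < k) (hp : p < n) :
    likWeight n pre i k (p + 1) ≤ likWeight n pre i k p := by
  have := Scard_le n pre i
  unfold likWeight
  split_ifs <;> omega

/-- `Lik` bounds from below the cost of every sequence visiting `σ q` at a position `q ≥ k`. -/
theorem Lik_le_totalT {n : ℕ} (hn : 1 ≤ n) {d : ℕ → ℕ → ℝ} (hd : ∀ i j, 0 ≤ d i j)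
    {pre : ℕ → ℕ → Prop} (hrefl : ∀ i ∈ Finset.Icc 1 n, pre i i) {σ : ℕ → ℕ}
    (hσ : Set.BijOn σ (Set.Icc 1 n) (Set.Icc 1 n)) {k q : ℕ} (hq : q ∈ Finset.Icc 1 n)
    (hk1 : n - Scard n pre (σ q) < k) (hk2 : k ≤ n) (hkq : k ≤ q) :
    Lik n d pre (σ q) k ≤ totalT n d pre σ := by
  rw [Lik_eq_sum_likWeight d hk1 hk2, totalT_eq_sum_card_mul]
  trans ∑ p ∈ Finset.Icc 1 n,
    (likWeight n pre (σ q) k p : ℝ) * d (jseq σ (p - 1)) (jseq σ p)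
  · have hpartial : ∀ P, P ≤ n →
        0 ≤ ∑ p ∈ Finset.Icc 1 P, (d (jseq σ (p - 1)) (jseq σ p) - sArc n d p) := by
      intro P hP
      rw [Finset.sum_sub_distrib]
      exact sub_nonneg.2 (sum_sArc_le_arrival d hσ hP)
    have h := (mul_nonneg (Nat.cast_nonneg _) (hpartial n le_rfl)).trans
      (mul_sum_le_sum_mul_of_antitone (w := fun p => (likWeight n pre (σ q) k p : ℝ)) hn
        (fun p _ hp => Nat.cast_le.2 (likWeight_succ_le hk1 hp)) hpartial)
    simpa only [mul_sub, Finset.sum_sub_distrib, sub_nonneg] using h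
  · refine Finset.sum_le_sum fun p hp => mul_le_mul_of_nonneg_right (Nat.cast_le.2 ?_) (hd _ _)
    unfold likWeight
    split_ifs with h
    · exact Scard_le_card_lastPos hq (h.2.trans hkq)
    · exact sub_add_one_le_card_lastPos hrefl hσ hp

/-- **Maximum-position rule.** Let `U` be an upper bound on the optimal
total service disruption time. If `L_i^k > U` for some `i ∈ V_c` and some position `k`
with `n − |S_i| < k ≤ n`, then every optimal repair sequence visits `i` strictly before
position `k`. -/
theorem stmt8
    (n : ℕ) (hn : 1 ≤ n)
    (d : ℕ → ℕ → ℝ) (hd : ∀ i j, 0 ≤ d i j)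
    (pre : ℕ → ℕ → Prop)
    (hrefl : ∀ i ∈ Finset.Icc 1 n, pre i i)
    (htrans : ∀ i j k, pre i j → pre j k → pre i k)
    (hantisymm : ∀ i j, pre i j → pre j i → i = j)
    (σ : ℕ → ℕ) (hσ : Set.BijOn σ (Set.Icc 1 n) (Set.Icc 1 n))
    (U : ℝ)
    (hU : ∃ τ : ℕ → ℕ, Set.BijOn τ (Set.Icc 1 n) (Set.Icc 1 n) ∧ totalT n d pre τ ≤ U)
    (i k : ℕ) (hi : i ∈ Finset.Icc 1 n)
    (hk1 : n - Scard n pre i < k) (hk2 : k ≤ n)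
    (hL : U < Lik n d pre i k)
    (hopt : ∀ τ : ℕ → ℕ, Set.BijOn τ (Set.Icc 1 n) (Set.Icc 1 n) →
      totalT n d pre σ ≤ totalT n d pre τ) :
    ∀ q ∈ Finset.Icc 1 n, σ q = i → q < k := by
  intro q hq hqi
  by_contra! hkq
  subst hqi
  obtain ⟨τ, hτ, hτU⟩ := hU
  exact absurd ((Lik_le_totalT hn hd hrefl hσ hq hk1 hk2 hkq).trans
    ((hopt τ hτ).trans hτU)) hL.not_ge
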